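/- Let d ∈ {2,3}, ρ > 0, h > 0, a > 0, ε > 0 with ε²a² < h, let v, H ∈ ℝ^d with ε²|v|² < 1, and let τ₂, …, τ_d ∈ ℝ; set N := (1, −τ₂, …, −τ_d) ∈ ℝ^d and s := v·N, and suppose H·N = 0. Define A_α(U) := 𝐉ᵀ B_α(V) 𝐉 for α = 0, 1, …, d. Then A₁(U) − s·A₀(U) − Σ_{i=2}^d τ_i A_i(U) equals the (2d+2)×(2d+2) matrix given in block form (blocks of sizes 1, d, d, 1) by [[0, ΓNᵀ, 0, 0], [ΓN, O_d, O_d, 0], [0, O_d, O_d, 0], [0, 0, 0, 0]], where Γ := (1 − ε²|v|²)^{−1/2}. -/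

import Mathlib

open Matrix

/-- The Lorentz factor `Γ = (1 − ε²|v|²)^{−1/2}`. -/
noncomputable def lorentz (d : ℕ) (ε : ℝ) (v : Fin d → ℝ) : ℝ :=
  (Real.sqrt (1 - ε ^ 2 * ∑ i, v i ^ 2))⁻¹

/-- `|b|² = ε²Γ⁻²|H|² + ε⁴(v·H)²`, the Minkowski norm squared of the magnetic field
`d`-vector. -/
noncomputable def bsq (d : ℕ) (ε : ℝ) (v H : Fin d → ℝ) : ℝ :=
  ε ^ 2 * (lorentz d ε v)⁻¹ ^ 2 * (∑ i, H i ^ 2) + ε ^ 4 * (∑ i, v i * H i) ^ 2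

/-- `M₀ = Γ⁻¹(I_d + ε²Γ² v⊗v)`. -/
noncomputable def M0rel (d : ℕ) (ε : ℝ) (v : Fin d → ℝ) : Matrix (Fin d) (Fin d) ℝ :=
  (lorentz d ε v)⁻¹ • ((1 : Matrix (Fin d) (Fin d) ℝ)
    + (ε ^ 2 * lorentz d ε v ^ 2) • vecMulVec v v)

/-- `𝒜₀`, the velocity block of the relativistic MHD symmetrizer `B₀(V)`. -/
noncomputable def calA0 (d : ℕ) (ε ρ h : ℝ) (v H : Fin d → ℝ) :
    Matrix (Fin d) (Fin d) ℝ :=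
  (ρ * h * lorentz d ε v + ε ^ 2 * (lorentz d ε v)⁻¹ * ∑ i, H i ^ 2) •
      ((1 : Matrix (Fin d) (Fin d) ℝ) - ε ^ 2 • vecMulVec v v)
    - (ε ^ 2 * (lorentz d ε v)⁻¹ * bsq d ε v H) • vecMulVec v v
    - (ε ^ 2 * (lorentz d ε v)⁻¹) • vecMulVec H H
    + (ε ^ 4 * (lorentz d ε v)⁻¹ * ∑ i, v i * H i) • (vecMulVec H v + vecMulVec v H)

/-- `𝒜ᵢ`, the velocity block of `Bᵢ(V)`, `i = 1, …, d`. -/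
noncomputable def calAi (d : ℕ) (ε ρ h : ℝ) (v H : Fin d → ℝ) (i : Fin d) :
    Matrix (Fin d) (Fin d) ℝ :=
  v i • ((ρ * h * lorentz d ε v + ε ^ 2 * (lorentz d ε v)⁻¹ * ∑ j, H j ^ 2) •
        ((1 : Matrix (Fin d) (Fin d) ℝ) - ε ^ 2 • vecMulVec v v)
      + (ε ^ 2 * (lorentz d ε v)⁻¹) • (bsq d ε v H • vecMulVec v v - vecMulVec H H))
    + (ε ^ 2 * (lorentz d ε v)⁻¹ * H i) •
        (((lorentz d ε v)⁻¹ ^ 2) • (vecMulVec H v + vecMulVec v H)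
          - (2 * ∑ j, v j * H j) •
              ((1 : Matrix (Fin d) (Fin d) ℝ) - ε ^ 2 • vecMulVec v v))
    + (lorentz d ε v)⁻¹ •
        vecMulVec ((ε ^ 2 * ∑ j, v j * H j) • H - bsq d ε v H • v) (Pi.single i 1)
    + (lorentz d ε v)⁻¹ •
        vecMulVec (Pi.single i 1) ((ε ^ 2 * ∑ j, v j * H j) • H - bsq d ε v H • v)

/-- `𝒩ᵢ = (Γ⁻²H + ε²(v·H)v)⊗(eᵢ − ε²vᵢv) − Γ⁻²Hᵢ I_d`. -/
noncomputable def calNi (d : ℕ) (ε : ℝ) (v H : Fin d → ℝ) (i : Fin d) :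
    Matrix (Fin d) (Fin d) ℝ :=
  vecMulVec (((lorentz d ε v)⁻¹ ^ 2) • H + (ε ^ 2 * ∑ j, v j * H j) • v)
      (Pi.single i 1 - (ε ^ 2 * v i) • v)
    - ((lorentz d ε v)⁻¹ ^ 2 * H i) • (1 : Matrix (Fin d) (Fin d) ℝ)

/-- Index type for the `(2d+2) × (2d+2)` matrices of the symmetrized ideal relativistic MHD
system, blocks of sizes `1, d, d, 1`. -/
abbrev RMHDIdx (d : ℕ) := Unit ⊕ Fin d ⊕ Fin d ⊕ Unit

/-- The symmetrizer `B₀(V)` of ideal relativistic MHD. -/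
noncomputable def B0mat (d : ℕ) (ε ρ h a : ℝ) (v H : Fin d → ℝ) :
    Matrix (RMHDIdx d) (RMHDIdx d) ℝ :=
  Matrix.of fun p q =>
    match p, q with
    | Sum.inl _, Sum.inl _ => lorentz d ε v / (ρ * a ^ 2)
    | Sum.inl _, Sum.inr (Sum.inl j) => ε ^ 2 * v j
    | Sum.inr (Sum.inl i), Sum.inl _ => ε ^ 2 * v i
    | Sum.inr (Sum.inl i), Sum.inr (Sum.inl j) => calA0 d ε ρ h v H i j
    | Sum.inr (Sum.inr (Sum.inl i)), Sum.inr (Sum.inr (Sum.inl j)) => M0rel d ε v i j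
    | Sum.inr (Sum.inr (Sum.inr _)), Sum.inr (Sum.inr (Sum.inr _)) => 1
    | _, _ => 0

/-- The matrices `Bᵢ(V)`, `i = 1, …, d`, of the symmetrized ideal relativistic MHD system. -/
noncomputable def Bimat (d : ℕ) (ε ρ h a : ℝ) (v H : Fin d → ℝ) (i : Fin d) :
    Matrix (RMHDIdx d) (RMHDIdx d) ℝ :=
  Matrix.of fun p q =>
    match p, q with
    | Sum.inl _, Sum.inl _ => lorentz d ε v * v i / (ρ * a ^ 2)
    | Sum.inl _, Sum.inr (Sum.inl j) => if i = j then 1 else 0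
    | Sum.inr (Sum.inl j), Sum.inl _ => if i = j then 1 else 0
    | Sum.inr (Sum.inl j), Sum.inr (Sum.inl k) => calAi d ε ρ h v H i j k
    | Sum.inr (Sum.inl j), Sum.inr (Sum.inr (Sum.inl k)) => calNi d ε v H i k j
    | Sum.inr (Sum.inr (Sum.inl j)), Sum.inr (Sum.inl k) => calNi d ε v H i j k
    | Sum.inr (Sum.inr (Sum.inl j)), Sum.inr (Sum.inr (Sum.inl k)) => v i * M0rel d ε v j k
    | Sum.inr (Sum.inr (Sum.inr _)), Sum.inr (Sum.inr (Sum.inr _)) => v i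
    | _, _ => 0

/-- The Jacobian `𝐉 = ∂V/∂U` of the change of unknowns `U = (q, v, H, S) ↦ V = (p, w, H, S)`
in ideal relativistic MHD, with `𝐚 = ε²(|H|²v − (v·H)H)` and `𝐛 = Γ⁻²H + ε²(v·H)v`. -/
noncomputable def Jac (d : ℕ) (ε : ℝ) (v H : Fin d → ℝ) :
    Matrix (RMHDIdx d) (RMHDIdx d) ℝ :=
  Matrix.of fun p q =>
    match p, q with
    | Sum.inl _, Sum.inl _ => 1
    | Sum.inl _, Sum.inr (Sum.inl j) =>
        ε ^ 2 * ((∑ k, H k ^ 2) * v j - (∑ k, v k * H k) * H j)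
    | Sum.inl _, Sum.inr (Sum.inr (Sum.inl j)) =>
        -((lorentz d ε v)⁻¹ ^ 2 * H j + ε ^ 2 * (∑ k, v k * H k) * v j)
    | Sum.inr (Sum.inl i), Sum.inr (Sum.inl j) => lorentz d ε v ^ 2 * M0rel d ε v i j
    | Sum.inr (Sum.inr (Sum.inl i)), Sum.inr (Sum.inr (Sum.inl j)) => if i = j then 1 else 0
    | Sum.inr (Sum.inr (Sum.inr _)), Sum.inr (Sum.inr (Sum.inr _)) => 1
    | _, _ => 0

/-- The boundary matrix `[[0, ΓNᵀ, 0, 0], [ΓN, O_d, O_d, 0], [0, O_d, O_d, 0], [0, 0, 0, 0]]`. -/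
noncomputable def relBdry (d : ℕ) (g : ℝ) (N : Fin d → ℝ) :
    Matrix (RMHDIdx d) (RMHDIdx d) ℝ :=
  Matrix.of fun p q =>
    match p, q with
    | Sum.inl _, Sum.inr (Sum.inl j) => g * N j
    | Sum.inr (Sum.inl i), Sum.inl _ => g * N i
    | _, _ => 0

/-- The vector `N − ε²(v·N)v`, the velocity part of the boundary symbol of ideal relativistic
MHD. -/
def conormal (d : ℕ) (ε : ℝ) (v N : Fin d → ℝ) : Fin d → ℝ :=
  fun j => N j - ε ^ 2 * (∑ k, v k * N k) * v j

/-- The vector `ε²(v·H)H − |b|²v`. -/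
noncomputable def magneticStress (d : ℕ) (ε : ℝ) (v H : Fin d → ℝ) : Fin d → ℝ :=
  fun j => ε ^ 2 * (∑ k, v k * H k) * H j - bsq d ε v H * v j

/-- The vector `(0, N − ε²(v·N)v, 0, 0)`. -/
def conormalExt (d : ℕ) (ε : ℝ) (v N : Fin d → ℝ) : RMHDIdx d → ℝ
  | Sum.inr (Sum.inl j) => conormal d ε v N j
  | _ => 0

/-- The vector `(1, Γ⁻¹(ε²(v·H)H − |b|²v), Γ⁻²H + ε²(v·H)v, 0)`, which is the gradient of the
pressure variable `q` with respect to `V`. -/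
noncomputable def pressureGrad (d : ℕ) (ε : ℝ) (v H : Fin d → ℝ) : RMHDIdx d → ℝ
  | Sum.inl _ => 1
  | Sum.inr (Sum.inl j) => (lorentz d ε v)⁻¹ * magneticStress d ε v H j
  | Sum.inr (Sum.inr (Sum.inl j)) =>
      (lorentz d ε v)⁻¹ ^ 2 * H j + ε ^ 2 * (∑ k, v k * H k) * v j
  | Sum.inr (Sum.inr (Sum.inr _)) => 0

theorem lorentz_ne_zero {d : ℕ} {ε : ℝ} {v : Fin d → ℝ} (hv : ε ^ 2 * ∑ i, v i ^ 2 < 1) :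
    lorentz d ε v ≠ 0 :=
  inv_ne_zero (Real.sqrt_pos.mpr (sub_pos.mpr hv)).ne'

theorem lorentz_inv_sq {d : ℕ} {ε : ℝ} {v : Fin d → ℝ} (hv : ε ^ 2 * ∑ i, v i ^ 2 < 1) :
    (lorentz d ε v)⁻¹ ^ 2 = 1 - ε ^ 2 * ∑ i, v i ^ 2 := by
  rw [lorentz, inv_inv, Real.sq_sqrt (sub_pos.mpr hv).le]

theorem sum_mul_affine_single {d : ℕ} (v H N : Fin d → ℝ) (hHN : ∑ i, H i * N i = 0)
    (α β γ δ : ℝ) (j k : Fin d) :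
    ∑ i, N i * (v i * α + H i * β + (if i = j then γ else 0) + (if i = k then δ else 0))
      = (∑ i, v i * N i) * α + N j * γ + N k * δ := by
  have hsplit : ∀ i,
      N i * (v i * α + H i * β + (if i = j then γ else 0) + (if i = k then δ else 0))
        = v i * N i * α + H i * N i * β + (if i = j then N i * γ else 0)
          + (if i = k then N i * δ else 0) := by
    intro i
    split_ifs <;> ring
  simp only [hsplit, Finset.sum_add_distrib, ← Finset.sum_mul, hHN, Finset.sum_ite_eq',
    Finset.mem_univ, if_true]
  ring

theorem sum_mul_calAi_sub_calA0 (d : ℕ) (ε ρ h : ℝ) (v H N : Fin d → ℝ)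
    (hHN : ∑ i, H i * N i = 0) (j k : Fin d) :
    ∑ i, N i * calAi d ε ρ h v H i j k - (∑ i, v i * N i) * calA0 d ε ρ h v H j k
      = (lorentz d ε v)⁻¹ * (magneticStress d ε v H j * conormal d ε v N k
          + conormal d ε v N j * magneticStress d ε v H k) := by
  have hentry : ∀ i, calAi d ε ρ h v H i j k
      = v i * ((ρ * h * lorentz d ε v + ε ^ 2 * (lorentz d ε v)⁻¹ * ∑ l, H l ^ 2)
            * ((1 : Matrix (Fin d) (Fin d) ℝ) j k - ε ^ 2 * (v j * v k))
          + ε ^ 2 * (lorentz d ε v)⁻¹ * (bsq d ε v H * (v j * v k) - H j * H k))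
        + H i * (ε ^ 2 * (lorentz d ε v)⁻¹ *
            ((lorentz d ε v)⁻¹ ^ 2 * (H j * v k + v j * H k)
              - (2 * ∑ l, v l * H l)
                * ((1 : Matrix (Fin d) (Fin d) ℝ) j k - ε ^ 2 * (v j * v k))))
        + (if i = k then (lorentz d ε v)⁻¹ * magneticStress d ε v H j else 0)
        + (if i = j then (lorentz d ε v)⁻¹ * magneticStress d ε v H k else 0) := by
    intro i
    simp only [calAi, magneticStress, Matrix.add_apply, Matrix.sub_apply, Matrix.smul_apply,
      vecMulVec_apply, Pi.sub_apply, Pi.smul_apply, smul_eq_mul, Pi.single_apply, eq_comm (b := i)]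
    split_ifs <;> ring
  simp only [hentry, sum_mul_affine_single v H N hHN]
  simp only [calA0, magneticStress, conormal, Matrix.add_apply, Matrix.sub_apply,
    Matrix.smul_apply, vecMulVec_apply, smul_eq_mul]
  ring

theorem sum_mul_calNi (d : ℕ) (ε : ℝ) (v H N : Fin d → ℝ) (hHN : ∑ i, H i * N i = 0)
    (j k : Fin d) :
    ∑ i, N i * calNi d ε v H i j k
      = ((lorentz d ε v)⁻¹ ^ 2 * H j + ε ^ 2 * (∑ l, v l * H l) * v j)
        * conormal d ε v N k := by
  have hentry : ∀ i, calNi d ε v H i j k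
      = v i * (-((lorentz d ε v)⁻¹ ^ 2 * H j + ε ^ 2 * (∑ l, v l * H l) * v j)
            * (ε ^ 2 * v k))
        + H i * (-((lorentz d ε v)⁻¹ ^ 2 * (1 : Matrix (Fin d) (Fin d) ℝ) j k))
        + (if i = k then
            (lorentz d ε v)⁻¹ ^ 2 * H j + ε ^ 2 * (∑ l, v l * H l) * v j else 0)
        + (if i = k then 0 else 0) := by
    intro i
    simp only [calNi, Matrix.sub_apply, Matrix.smul_apply, vecMulVec_apply, Pi.add_apply,
      Pi.sub_apply, Pi.smul_apply, smul_eq_mul, Pi.single_apply, eq_comm (b := i)]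
    split_ifs <;> ring
  simp only [hentry, sum_mul_affine_single v H N hHN]
  simp only [conormal]
  ring

/-- The boundary symbol of the symmetrized system in the unknowns `V` is the symmetric product of
the pressure gradient and the extended conormal. -/
theorem sum_smul_Bimat_sub_B0mat (d : ℕ) (ε ρ h a : ℝ) (v H N : Fin d → ℝ)
    (hHN : ∑ i, H i * N i = 0) :
    ∑ i, N i • Bimat d ε ρ h a v H i - (∑ i, v i * N i) • B0mat d ε ρ h a v H
      = vecMulVec (pressureGrad d ε v H) (conormalExt d ε v N)
        + vecMulVec (conormalExt d ε v N) (pressureGrad d ε v H) := by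
  ext p q
  simp only [Matrix.sub_apply, Matrix.sum_apply, Matrix.smul_apply, Matrix.add_apply,
    vecMulVec_apply, smul_eq_mul]
  rcases p with _ | j | j | _ <;> rcases q with _ | k | k | _ <;>
    simp only [Bimat, B0mat, Matrix.of_apply, pressureGrad, conormalExt, mul_zero, zero_mul,
      Finset.sum_const_zero, sub_zero, add_zero, zero_add, mul_one, one_mul,
      sum_mul_calNi _ _ _ _ _ hHN, sum_mul_calAi_sub_calA0 _ _ _ _ _ _ _ hHN, mul_ite,
      Finset.sum_ite_eq', Finset.mem_univ,
      if_true]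
  · rw [Finset.sum_mul, ← Finset.sum_sub_distrib]
    exact Finset.sum_eq_zero fun i _ => by ring
  · simp only [conormal]; ring
  · simp only [conormal]; ring
  · ring
  · ring
  · rw [Finset.sum_mul, ← Finset.sum_sub_distrib]
    exact Finset.sum_eq_zero fun i _ => by ring
  · simp only [mul_comm, sub_self]

theorem vecMul_M0rel (d : ℕ) (ε : ℝ) (v x : Fin d → ℝ) (k : Fin d) :
    ∑ j, x j * M0rel d ε v j k
      = (lorentz d ε v)⁻¹ * (x k + ε ^ 2 * lorentz d ε v ^ 2 * (∑ j, v j * x j) * v k) := by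
  have hentry : ∀ j, x j * M0rel d ε v j k
      = (lorentz d ε v)⁻¹ * (if j = k then x j else 0)
        + v j * x j * ((lorentz d ε v)⁻¹ * (ε ^ 2 * lorentz d ε v ^ 2) * v k) := by
    intro j
    simp only [M0rel, Matrix.smul_apply, Matrix.add_apply, vecMulVec_apply, Matrix.one_apply,
      smul_eq_mul]
    split_ifs <;> ring
  simp only [hentry, Finset.sum_add_distrib, ← Finset.mul_sum, ← Finset.sum_mul,
    Finset.sum_ite_eq', Finset.mem_univ, if_true]
  ring

theorem sum_mul_conormal (d : ℕ) (ε : ℝ) (v N : Fin d → ℝ) :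
    ∑ j, v j * conormal d ε v N j
      = (∑ j, v j * N j) * (1 - ε ^ 2 * ∑ j, v j ^ 2) := by
  have hentry : ∀ j, v j * conormal d ε v N j
      = v j * N j - v j ^ 2 * (ε ^ 2 * ∑ k, v k * N k) := by
    intro j
    simp only [conormal]
    ring
  simp only [hentry, Finset.sum_sub_distrib, ← Finset.sum_mul]
  ring

theorem sum_mul_magneticStress (d : ℕ) (ε : ℝ) (v H : Fin d → ℝ) :
    ∑ j, v j * magneticStress d ε v H j
      = ε ^ 2 * (∑ j, v j * H j) ^ 2 - bsq d ε v H * ∑ j, v j ^ 2 := by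
  have hentry : ∀ j, v j * magneticStress d ε v H j
      = v j * H j * (ε ^ 2 * ∑ k, v k * H k) - v j ^ 2 * bsq d ε v H := by
    intro j
    simp only [magneticStress]
    ring
  simp only [hentry, Finset.sum_sub_distrib, ← Finset.sum_mul]
  ring

theorem conormalExt_vecMul_Jac {d : ℕ} {ε : ℝ} {v : Fin d → ℝ} (H N : Fin d → ℝ)
    (hv : ε ^ 2 * ∑ i, v i ^ 2 < 1) :
    conormalExt d ε v N ᵥ* Jac d ε v H
      = Sum.elim (fun _ => 0) (Sum.elim (fun j => lorentz d ε v * N j) fun _ => 0) := by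
  have hg := lorentz_ne_zero hv
  ext q
  simp only [vecMul, dotProduct, Fintype.sum_sum_type]
  rcases q with _ | k | k | _ <;>
    simp only [conormalExt, Jac, Matrix.of_apply, zero_mul, mul_zero, Finset.sum_const_zero,
      zero_add, add_zero, Sum.elim_inl, Sum.elim_inr]
  simp only [mul_left_comm _ (lorentz d ε v ^ 2), ← Finset.mul_sum, vecMul_M0rel,
    sum_mul_conormal, ← lorentz_inv_sq hv]
  simp only [conormal]
  field_simp
  ring

theorem pressureGrad_vecMul_Jac {d : ℕ} {ε : ℝ} {v : Fin d → ℝ} (H : Fin d → ℝ)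
    (hv : ε ^ 2 * ∑ i, v i ^ 2 < 1) :
    pressureGrad d ε v H ᵥ* Jac d ε v H = Sum.elim (fun _ => 1) fun _ => 0 := by
  have hg := lorentz_ne_zero hv
  have hsq := lorentz_inv_sq hv
  ext q
  simp only [vecMul, dotProduct, Fintype.sum_sum_type]
  rcases q with _ | k | k | _ <;>
    simp only [pressureGrad, Jac, Matrix.of_apply, mul_zero, Finset.sum_const_zero,
      zero_add, add_zero, Sum.elim_inl, Sum.elim_inr,
      Finset.univ_unique, Finset.sum_singleton, mul_one, one_mul, mul_ite, Finset.sum_ite_eq',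
      Finset.mem_univ, if_true, neg_add_cancel]
  have hlin : ∀ j, (lorentz d ε v)⁻¹ * magneticStress d ε v H j
        * (lorentz d ε v ^ 2 * M0rel d ε v j k)
      = lorentz d ε v * (magneticStress d ε v H j * M0rel d ε v j k) := by
    intro j
    field_simp
  simp only [hlin, ← Finset.mul_sum, vecMul_M0rel, sum_mul_magneticStress]
  have hcoef : ε ^ 2 * ∑ j, H j ^ 2 - bsq d ε v H * (1 + ε ^ 2 * lorentz d ε v ^ 2 * ∑ j, v j ^ 2)
      + ε ^ 4 * lorentz d ε v ^ 2 * (∑ j, v j * H j) ^ 2 = 0 := by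
    have hone : 1 + ε ^ 2 * lorentz d ε v ^ 2 * ∑ j, v j ^ 2 = lorentz d ε v ^ 2 := by
      field_simp at hsq
      linarith
    rw [hone, bsq]
    field_simp
    ring
  rw [← mul_assoc, mul_inv_cancel₀ hg]
  simp only [magneticStress]
  linear_combination v k * hcoef

theorem transpose_mul_vecMulVec_mul {m n : Type*} [Fintype m] (J : Matrix m n ℝ)
    (x y : m → ℝ) : Jᵀ * vecMulVec x y * J = vecMulVec (x ᵥ* J) (y ᵥ* J) := by
  rw [mul_vecMulVec, vecMulVec_mul, mulVec_transpose]

/-- With `A_α(U) = 𝐉ᵀ B_α(V) 𝐉`, `N = (1, −τ₂, …, −τ_d)`, `s = v·N`, and `H·N = 0`, the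
combination `A₁ − s A₀ − Σ_{i=2}^d τᵢ Aᵢ` equals
`[[0, ΓNᵀ, 0, 0], [ΓN, O_d, O_d, 0], [0, O_d, O_d, 0], [0, 0, 0, 0]]`.
(Here the spatial matrices `A₁, …, A_d` are indexed by `Fin d`, with index `0 ↔ A₁` and
index `i ≠ 0 ↔ A_{i+1}`, `τ` likewise.) -/
theorem stmt15 (d : ℕ) [NeZero d] (hd : d = 2 ∨ d = 3) (ρ h a ε : ℝ)
    (hρ : 0 < ρ) (hh : 0 < h) (ha : 0 < a) (hε : 0 < ε) (hsub : ε ^ 2 * a ^ 2 < h)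
    (v H : Fin d → ℝ) (hv : ε ^ 2 * ∑ i, v i ^ 2 < 1)
    (τ N : Fin d → ℝ) (hN : ∀ i, N i = if i = 0 then 1 else -τ i)
    (hHN : ∑ i, H i * N i = 0) :
    (Jac d ε v H)ᵀ * Bimat d ε ρ h a v H 0 * Jac d ε v H
      - (∑ i, v i * N i) • ((Jac d ε v H)ᵀ * B0mat d ε ρ h a v H * Jac d ε v H)
      - ∑ i ∈ Finset.univ.erase (0 : Fin d),
          τ i • ((Jac d ε v H)ᵀ * Bimat d ε ρ h a v H i * Jac d ε v H)
      = relBdry d (lorentz d ε v) N := by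
  have hsum : ∀ F : Fin d → Matrix (RMHDIdx d) (RMHDIdx d) ℝ,
      ∑ i, N i • F i = F 0 - ∑ i ∈ Finset.univ.erase (0 : Fin d), τ i • F i := by
    intro F
    rw [← Finset.add_sum_erase _ _ (Finset.mem_univ (0 : Fin d)), hN 0, if_pos rfl, one_smul,
      sub_eq_add_neg, ← Finset.sum_neg_distrib]
    congr 1
    refine Finset.sum_congr rfl fun i hi => ?_
    rw [hN i, if_neg (Finset.ne_of_mem_erase hi), neg_smul]
  rw [sub_right_comm,
    ← hsum fun i => (Jac d ε v H)ᵀ * Bimat d ε ρ h a v H i * Jac d ε v H]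
  have hconj : ∑ i, N i • ((Jac d ε v H)ᵀ * Bimat d ε ρ h a v H i * Jac d ε v H)
        - (∑ i, v i * N i) • ((Jac d ε v H)ᵀ * B0mat d ε ρ h a v H * Jac d ε v H)
      = (Jac d ε v H)ᵀ * (∑ i, N i • Bimat d ε ρ h a v H i
          - (∑ i, v i * N i) • B0mat d ε ρ h a v H) * Jac d ε v H := by
    simp only [Matrix.mul_sub, Matrix.sub_mul, Matrix.mul_sum, Matrix.sum_mul, Matrix.mul_smul,
      Matrix.smul_mul]
  rw [hconj, sum_smul_Bimat_sub_B0mat d ε ρ h a v H N hHN, Matrix.mul_add, Matrix.add_mul,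
    transpose_mul_vecMulVec_mul, transpose_mul_vecMulVec_mul, conormalExt_vecMul_Jac H N hv,
    pressureGrad_vecMul_Jac H hv]
  ext p q
  rcases p with _ | j | j | _ <;> rcases q with _ | k | k | _ <;>
    simp [relBdry, vecMulVec_apply]
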